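/- arXiv:0910.4551 — 4 statements merged into one kernel-verified Lean document; each statement's English description precedes it below -/
import Mathlib

section
/- Let E ⊂ ℂ be compact, let μ be a Borel probability measure on E, and let k ∈ ℕ, ε > 0. Then there exists d₀ ∈ ℕ such that for all d ≥ d₀ and all λ ∈ G̃_d(μ, k, ε), every λ' ∈ Δ_d(λ) with λ' ∈ E^d satisfies λ' ∈ G̃_d(μ, k, 2ε). -/
open MeasureTheory Filter Set
open scoped ENNReal NNReal Topology BigOperators

noncomputable section

/-- Extended logarithm on `ℝ≥0∞`, with `elog 0 = ⊥` and `elog ⊤ = ⊤`. -/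
def elog (x : ℝ≥0∞) : EReal :=
  if x = 0 then ⊥ else if x = ⊤ then ⊤ else ((Real.log x.toReal : ℝ) : EReal)

/-- The empirical measure `κ_d(λ) = (1/d) ∑_j δ_{λ_j}`. -/
def empMeasure (d : ℕ) (l : Fin d → ℂ) : MeasureTheory.Measure ℂ :=
  (d : ℝ≥0∞)⁻¹ • ∑ j : Fin d, MeasureTheory.Measure.dirac (l j)

/-- The weak* moment neighborhood `G(μ,k,ε)`: Borel probability measures on `E` whose
real moments of total order `≤ k` are within `ε` of those of `μ`. -/
def momentNbhd (E : Set ℂ) (μ : MeasureTheory.Measure ℂ) (k : ℕ) (ε : ℝ) :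
    Set (MeasureTheory.Measure ℂ) :=
  {ν | MeasureTheory.IsProbabilityMeasure ν ∧ ν Eᶜ = 0 ∧
    ∀ n₁ n₂ : ℕ, n₁ + n₂ ≤ k →
      |(∫ z, z.re ^ n₁ * z.im ^ n₂ ∂μ) - ∫ z, z.re ^ n₁ * z.im ^ n₂ ∂ν| < ε}

/-- `G̃_d(μ,k,ε) = {λ ∈ E^d : κ_d(λ) ∈ G(μ,k,ε)}`. -/
def GT (E : Set ℂ) (d : ℕ) (μ : MeasureTheory.Measure ℂ) (k : ℕ) (ε : ℝ) :
    Set (Fin d → ℂ) :=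
  {l | (∀ j, l j ∈ E) ∧ empMeasure d l ∈ momentNbhd E μ k ε}

/-- The VanDerMonde determinant `VDM_d(λ) = ∏_{i<j} (λ_i - λ_j)`. -/
def vdm (d : ℕ) (l : Fin d → ℂ) : ℂ :=
  ∏ i : Fin d, ∏ j ∈ Finset.Ioi i, (l i - l j)

/-- The weighted VanDerMonde `VDM^w_d(λ) = VDM_d(λ) ∏_i w(λ_i)^d`. -/
def vdmW (w : ℂ → ℝ) (d : ℕ) (l : Fin d → ℂ) : ℂ :=
  vdm d l * ∏ i : Fin d, (w (l i) : ℂ) ^ d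

/-- A (compact, axis-parallel, nondegenerate) rectangle in `ℂ ≅ ℝ²`. -/
def IsRectangle (H : Set ℂ) : Prop :=
  ∃ a b c e : ℝ, a < b ∧ c < e ∧
    H = {z : ℂ | z.re ∈ Set.Icc a b ∧ z.im ∈ Set.Icc c e}

/-- The free entropy `Σ(μ) = ∫∫ log|z-t| dμ(z)dμ(t)`, with values in `[-∞,∞)` for
compactly supported `μ` (positive part minus negative part, as an extended real). -/
def freeEntropy (μ : MeasureTheory.Measure ℂ) : EReal :=
  (((∫⁻ p : ℂ × ℂ, ENNReal.ofReal (Real.log ‖p.1 - p.2‖) ∂(μ.prod μ)).toReal : ℝ) : EReal)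
    - ((∫⁻ p : ℂ × ℂ, ENNReal.ofReal (-Real.log ‖p.1 - p.2‖) ∂(μ.prod μ) : ℝ≥0∞) : EReal)

/-- The density condition (3.10): `τ(D(z₀,r)) ≥ r^T` for all `z₀ ∈ E` and `0 < r ≤ r₀`. -/
def DensityCond (E : Set ℂ) (τ : MeasureTheory.Measure ℂ) : Prop :=
  ∃ T : ℝ, 0 < T ∧ ∃ r₀ : ℝ, 0 < r₀ ∧ ∀ z₀ ∈ E, ∀ r : ℝ, 0 < r → r ≤ r₀ →
    ENNReal.ofReal (r ^ T) ≤ τ (Metric.closedBall z₀ r)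

/-- `J^φ_d(μ,k,ε) = ∫_{G̃_d(μ,k,ε)} |VDM^φ_d(λ)|² dτ(λ₁)⋯dτ(λ_d)`. -/
def Jint (H : Set ℂ) (τ : MeasureTheory.Measure ℂ) (φ : ℂ → ℝ)
    (μ : MeasureTheory.Measure ℂ) (k : ℕ) (ε : ℝ) (d : ℕ) : ℝ≥0∞ :=
  ∫⁻ l in GT H d μ k ε, ENNReal.ofReal (‖vdmW φ d l‖ ^ 2)
    ∂(MeasureTheory.Measure.pi fun _ : Fin d => τ)

/-- The sup norm `‖p‖_H` of a two-variable real polynomial over `H ⊂ ℂ ≅ ℝ²`. -/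
def supOn (H : Set ℂ) (p : MvPolynomial (Fin 2) ℝ) : ℝ :=
  sSup ((fun z : ℂ => |MvPolynomial.eval ![z.re, z.im] p|) '' H)

/-- The Euclidean norm of the gradient of a two-variable real polynomial at `z ∈ ℂ ≅ ℝ²`. -/
def gradNorm (p : MvPolynomial (Fin 2) ℝ) (z : ℂ) : ℝ :=
  Real.sqrt ((MvPolynomial.eval ![z.re, z.im] (MvPolynomial.pderiv 0 p)) ^ 2 +
    (MvPolynomial.eval ![z.re, z.im] (MvPolynomial.pderiv 1 p)) ^ 2)

/-- Evaluation of a polynomial in `2d` real variables at a point of `ℂ^d ≅ (ℝ²)^d`. -/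
def evalPt (d : ℕ) (P : MvPolynomial (Fin d × Fin 2) ℝ) (l : Fin d → ℂ) : ℝ :=
  MvPolynomial.eval (fun q : Fin d × Fin 2 => ![(l q.1).re, (l q.1).im] q.2) P

theorem integral_empMeasure (d : ℕ) (l : Fin d → ℂ) (f : ℂ → ℝ) :
    ∫ z, f z ∂(empMeasure d l) = (d : ℝ)⁻¹ * ∑ j, f (l j) := by
  have hint : ∀ j ∈ (Finset.univ : Finset (Fin d)), Integrable f (Measure.dirac (l j)) :=
    fun j _ => integrable_dirac (by simp)
  rw [empMeasure, integral_smul_measure, integral_finsetSum_measure hint]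
  simp

theorem isProbabilityMeasure_empMeasure {d : ℕ} (hd : d ≠ 0) (l : Fin d → ℂ) :
    IsProbabilityMeasure (empMeasure d l) := by
  constructor
  simp [empMeasure, ENNReal.inv_mul_cancel, hd]

theorem empMeasure_compl_eq_zero {E : Set ℂ} (hE : MeasurableSet E) {d : ℕ} {l : Fin d → ℂ}
    (hl : ∀ j, l j ∈ E) : empMeasure d l Eᶜ = 0 := by
  simp [empMeasure, hE.compl, hl]

/-- Integrals of a function continuous on a compact set against empirical measures change little
under perturbations of size `exp (-√d)` inside that set. -/
theorem eventually_abs_integral_empMeasure_sub_lt {E : Set ℂ} (hE : IsCompact E) {f : ℂ → ℝ}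
    (hf : ContinuousOn f E) {ε : ℝ} (hε : 0 < ε) :
    ∀ᶠ d : ℕ in atTop, ∀ l l' : Fin d → ℂ, (∀ j, l j ∈ E) → (∀ j, l' j ∈ E) →
      (∀ j, ‖l' j - l j‖ ≤ Real.exp (-Real.sqrt d)) →
      |∫ z, f z ∂(empMeasure d l) - ∫ z, f z ∂(empMeasure d l')| < ε := by
  obtain ⟨δ, hδ, hfδ⟩ :=
    Metric.uniformContinuousOn_iff.1 (hE.uniformContinuousOn_of_continuous hf) (ε / 2) (half_pos hε)
  have hlim : Tendsto (fun d : ℕ => Real.exp (-Real.sqrt d)) atTop (𝓝 0) :=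
    Real.tendsto_exp_neg_atTop_nhds_zero.comp
      (Real.tendsto_sqrt_atTop.comp tendsto_natCast_atTop_atTop)
  filter_upwards [hlim.eventually (gt_mem_nhds hδ), eventually_ge_atTop 1]
    with d hd hd1 l l' hl hl' hll'
  have hd0 : (0 : ℝ) < d := by exact_mod_cast hd1
  rw [integral_empMeasure, integral_empMeasure, ← mul_sub, ← Finset.sum_sub_distrib, abs_mul,
    abs_of_pos (inv_pos.2 hd0)]
  have hsum : |∑ j, (f (l j) - f (l' j))| ≤ d * (ε / 2) := by
    calc |∑ j, (f (l j) - f (l' j))| ≤ ∑ j, |f (l j) - f (l' j)| := Finset.abs_sum_le_sum_abs _ _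
      _ ≤ ∑ _j : Fin d, ε / 2 := by
        refine Finset.sum_le_sum fun j _ => ?_
        have h := hfδ (l j) (hl j) (l' j) (hl' j)
          (by rw [dist_comm, dist_eq_norm]; exact (hll' j).trans_lt hd)
        exact (Real.dist_eq _ _ ▸ h).le
      _ = d * (ε / 2) := by simp
  calc (d : ℝ)⁻¹ * |∑ j, (f (l j) - f (l' j))| ≤ (d : ℝ)⁻¹ * (d * (ε / 2)) := by gcongr
    _ = ε / 2 := by field_simp
    _ < ε := half_lt_self hε

/-- Proposition 1.3. -/
theorem perturbation_stays_in_nbhd (E : Set ℂ) (hE : IsCompact E)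
    (μ : MeasureTheory.Measure ℂ) [MeasureTheory.IsProbabilityMeasure μ] (hμE : μ Eᶜ = 0)
    (k : ℕ) (ε : ℝ) (hε : 0 < ε) :
    ∃ d₀ : ℕ, ∀ d : ℕ, d₀ ≤ d → ∀ l ∈ GT E d μ k ε, ∀ l' : Fin d → ℂ,
      (∀ j, ‖l' j - l j‖ ≤ Real.exp (-Real.sqrt d)) → (∀ j, l' j ∈ E) →
      l' ∈ GT E d μ k (2 * ε) := by
  have hmom : ∀ᶠ d : ℕ in atTop, ∀ p ∈ Finset.range (k + 1) ×ˢ Finset.range (k + 1),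
      ∀ l l' : Fin d → ℂ, (∀ j, l j ∈ E) → (∀ j, l' j ∈ E) →
      (∀ j, ‖l' j - l j‖ ≤ Real.exp (-Real.sqrt d)) →
      |∫ z, z.re ^ p.1 * z.im ^ p.2 ∂(empMeasure d l) -
        ∫ z, z.re ^ p.1 * z.im ^ p.2 ∂(empMeasure d l')| < ε :=
    (Filter.eventually_all_finset _).2 fun p _ =>
      eventually_abs_integral_empMeasure_sub_lt hE
        (f := fun z : ℂ => z.re ^ p.1 * z.im ^ p.2) (by fun_prop) hε
  obtain ⟨d₀, hd₀⟩ := eventually_atTop.1 (hmom.and (eventually_ge_atTop 1))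
  refine ⟨d₀, fun d hd l hl l' hll' hl' => ?_⟩
  obtain ⟨hclose, hd1⟩ := hd₀ d hd
  refine ⟨hl', isProbabilityMeasure_empMeasure (by omega) l',
    empMeasure_compl_eq_zero hE.measurableSet hl', fun n₁ n₂ hn => ?_⟩
  have h := hclose (n₁, n₂) (by simp only [Finset.mem_product, Finset.mem_range]; omega)
    l l' hl.1 hl' hll'
  calc _ ≤ _ := abs_sub_le _ (∫ z, z.re ^ n₁ * z.im ^ n₂ ∂(empMeasure d l)) _
    _ < ε + ε := add_lt_add (hl.2.2.2 n₁ n₂ hn) h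
    _ = 2 * ε := (two_mul ε).symm

end
end

section
/- Let H ⊂ ℝ² be a rectangle, and let c₁ > 0, γ₁ > 0. Let (Λ_d)_{d≥1} be a sequence of real polynomials on (ℝ²)^d, each nonnegative on H^d, such that Λ_d has degree at most c₁ d^{γ₁} in each of its 2d real variables. For each d let z^M ∈ H^d be a point where Λ_d attains its maximum over H^d, i.e. Λ_d(z^M) = ‖Λ_d‖_{H^d}. Then there exist constants c > 0 and γ > 0, independent of d, such that for all d and all z ∈ Δ_d(z^M) ∩ H^d one has Λ_d(z) ≥ Λ_d(z^M) · (1 − c d^γ e^{−√d}). -/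
open MeasureTheory Filter Set
open scoped ENNReal NNReal Topology BigOperators

noncomputable section

namespace Polynomial

/-- Markov's inequality at an endpoint, transported to the segment from `u - v` to `u + v`. -/
theorem abs_mul_eval_derivative_le_of_abs_le {p : Polynomial ℝ} {n : ℕ} {M u v : ℝ} (hM : 0 < M)
    (hdeg : p.natDegree ≤ n) (hp : ∀ t ∈ Set.Icc (-1 : ℝ) 1, |p.eval (u + v * t)| ≤ M) :
    |v * (derivative p).eval (u + v)| ≤ M * (n : ℝ) ^ 2 := by
  have upper : ∀ s : ℝ, |s| = M⁻¹ → s * (v * (derivative p).eval (u + v)) ≤ (n : ℝ) ^ 2 := by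
    intro s hs
    have h := Chebyshev.eval_iterate_derivative_le_of_forall_abs_le_one
      (n := n) (P := C s * p.comp (C u + C v * X)) (k := 1) (x := 1) le_rfl ?_ ?_
    · simpa [derivative_comp, Chebyshev.derivative_T_eval_one] using h
    · refine degree_le_of_natDegree_le ((natDegree_C_mul_le _ _).trans (natDegree_comp_le.trans ?_))
      have hlin : (C u + C v * X : Polynomial ℝ).natDegree ≤ 1 := by compute_degree
      exact (Nat.mul_le_mul hdeg hlin).trans (mul_one n).le
    · intro t ht
      have := hp t ht
      simp only [eval_mul, eval_C, eval_comp, eval_add, eval_X, abs_mul, hs]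
      rw [inv_mul_le_iff₀ hM]
      simpa using this
  have h₁ := upper M⁻¹ (abs_of_pos (inv_pos.2 hM))
  have h₂ := upper (-M⁻¹) (by rw [abs_neg, abs_of_pos (inv_pos.2 hM)])
  rw [inv_mul_le_iff₀ hM] at h₁
  rw [neg_mul, ← mul_neg, inv_mul_le_iff₀ hM] at h₂
  exact abs_le'.2 ⟨h₁, h₂⟩

/-- Markov's inequality on `[a, b]`, up to a factor of two in the constant. -/
theorem abs_eval_derivative_le_of_abs_le {p : Polynomial ℝ} {n : ℕ} {M a b x : ℝ} (hM : 0 < M)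
    (hab : a < b) (hdeg : p.natDegree ≤ n) (hp : ∀ t ∈ Set.Icc a b, |p.eval t| ≤ M)
    (hx : x ∈ Set.Icc a b) :
    |(derivative p).eval x| ≤ 4 * (n : ℝ) ^ 2 * M / (b - a) := by
  have main : ∀ e ∈ Set.Icc a b, b - a ≤ 2 * |x - e| →
      |(derivative p).eval x| ≤ 4 * (n : ℝ) ^ 2 * M / (b - a) := by
    intro e he hlong
    have h := abs_mul_eval_derivative_le_of_abs_le (u := (x + e) / 2) (v := (x - e) / 2)
      hM hdeg (fun t ht => hp _ ?_)
    · rw [show (x + e) / 2 + (x - e) / 2 = x by ring, abs_mul, abs_div, abs_two] at h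
      rw [le_div_iff₀ (sub_pos.2 hab)]
      nlinarith [abs_nonneg ((derivative p).eval x)]
    · have := (convex_Icc a b) hx he (a := (1 + t) / 2) (b := (1 - t) / 2)
        (by linarith [ht.1]) (by linarith [ht.2]) (by ring)
      convert this using 1
      simp only [smul_eq_mul]
      ring
  rcases le_total (b - a) (2 * (x - a)) with h | h
  · exact main a ⟨le_rfl, hab.le⟩ (by rwa [abs_of_nonneg (sub_nonneg.2 hx.1)])
  · refine main b ⟨hab.le, le_rfl⟩ ?_
    rw [abs_sub_comm, abs_of_nonneg (sub_nonneg.2 hx.2)]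
    linarith

theorem abs_eval_sub_eval_le_of_abs_le {p : Polynomial ℝ} {n : ℕ} {M a b x y : ℝ} (hM : 0 < M)
    (hab : a < b) (hdeg : p.natDegree ≤ n) (hp : ∀ t ∈ Set.Icc a b, |p.eval t| ≤ M)
    (hx : x ∈ Set.Icc a b) (hy : y ∈ Set.Icc a b) :
    |p.eval y - p.eval x| ≤ 4 * (n : ℝ) ^ 2 * M / (b - a) * |y - x| :=
  (convex_Icc a b).norm_image_sub_le_of_norm_hasDerivWithin_le
    (fun t _ => (p.hasDerivAt t).hasDerivWithinAt)
    (fun _ ht => abs_eval_derivative_le_of_abs_le hM hab hdeg hp ht) hx hy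

end Polynomial

namespace MvPolynomial

variable {ι R : Type*} [DecidableEq ι] [CommRing R]

/-- The restriction of `P` to the line through `x` parallel to the `i`-th axis. -/
def restrictLine (P : MvPolynomial ι R) (x : ι → R) (i : ι) : Polynomial R :=
  aeval (Function.update (fun j => Polynomial.C (x j)) i Polynomial.X) P

theorem eval_restrictLine (P : MvPolynomial ι R) (x : ι → R) (i : ι) (t : R) :
    (P.restrictLine x i).eval t = eval (Function.update x i t) P := by
  rw [restrictLine, ← Polynomial.coe_evalRingHom, map_aeval, eval, coe_eval₂Hom]
  congr 1
  · ext r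
    simp
  · ext j
    rcases eq_or_ne j i with rfl | hj <;> simp [*]

theorem natDegree_restrictLine_le (P : MvPolynomial ι R) (x : ι → R) (i : ι) :
    (P.restrictLine x i).natDegree ≤ P.degreeOf i := by
  rw [restrictLine, aeval_def, eval₂_eq]
  refine Polynomial.natDegree_sum_le_of_forall_le _ _ fun m hm => ?_
  refine (Polynomial.natDegree_C_mul_le _ _).trans ?_
  refine (Polynomial.natDegree_prod_le _ _).trans ?_
  calc _ ≤ ∑ j ∈ m.support, if j = i then m i else 0 := by
        refine Finset.sum_le_sum fun j _ => Polynomial.natDegree_pow_le.trans ?_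
        rcases eq_or_ne j i with rfl | hj
        · simpa using Nat.mul_le_mul_left (m j) (Polynomial.natDegree_X_le (R := R))
        · simp [hj]
    _ ≤ m i := by
        rw [Finset.sum_ite_eq']
        split_ifs <;> simp
    _ ≤ P.degreeOf i := monomial_le_degreeOf i hm

/-- A polynomial bounded by `M` on a box is Lipschitz there, with a constant polynomial in the
degree in each variable. -/
theorem abs_eval_sub_eval_le_of_abs_le_on_box [Fintype ι] {P : MvPolynomial ι ℝ} {a b : ι → ℝ}
    {L M D δ : ℝ} (hL : 0 < L) (hM : 0 < M) (hab : ∀ i, L ≤ b i - a i)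
    (hdeg : ∀ i, (P.degreeOf i : ℝ) ≤ D) (hP : ∀ x ∈ Set.Icc a b, |eval x P| ≤ M)
    {x y : ι → ℝ} (hx : x ∈ Set.Icc a b) (hy : y ∈ Set.Icc a b) (hxy : ∀ i, |y i - x i| ≤ δ) :
    |eval y P - eval x P| ≤ Fintype.card ι * (4 * D ^ 2 * M / L * δ) := by
  have step : ∀ z ∈ Set.Icc a b, ∀ i, ∀ t ∈ Set.Icc (a i) (b i), |t - z i| ≤ δ →
      |eval (Function.update z i t) P - eval z P| ≤ 4 * D ^ 2 * M / L * δ := by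
    intro z hz i t ht htz
    have hmem : ∀ s ∈ Set.Icc (a i) (b i), Function.update z i s ∈ Set.Icc a b := fun s hs =>
      ⟨le_update_iff.2 ⟨hs.1, fun j _ => hz.1 j⟩, update_le_iff.2 ⟨hs.2, fun j _ => hz.2 j⟩⟩
    have h := Polynomial.abs_eval_sub_eval_le_of_abs_le (p := P.restrictLine z i) hM
      (by linarith [hab i]) (natDegree_restrictLine_le P z i)
      (fun s hs => by rw [eval_restrictLine]; exact hP _ (hmem s hs)) ⟨hz.1 i, hz.2 i⟩ ht
    rw [eval_restrictLine, eval_restrictLine, Function.update_eq_self] at h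
    refine h.trans ?_
    gcongr
    · exact hdeg i
    · exact hab i
  have key : ∀ s : Finset ι, |eval (s.piecewise y x) P - eval x P| ≤
      s.card * (4 * D ^ 2 * M / L * δ) := by
    intro s
    induction s using Finset.induction_on with
    | empty => simp
    | insert i s hi ih =>
      have hz : s.piecewise y x ∈ Set.Icc a b :=
        ⟨s.le_piecewise_of_le_of_le hy.1 hx.1, s.piecewise_le_of_le_of_le hy.2 hx.2⟩
      have h := step _ hz i (y i) ⟨hy.1 i, hy.2 i⟩ (by simpa [hi] using hxy i)
      rw [Finset.piecewise_insert, Finset.card_insert_of_notMem hi]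
      push_cast
      linarith [abs_sub_le (eval (Function.update (s.piecewise y x) i (y i)) P)
        (eval (s.piecewise y x) P) (eval x P)]
  simpa using key Finset.univ

end MvPolynomial

/-- Theorem 2.1. -/
theorem near_max_lower_bound (H : Set ℂ) (hH : IsRectangle H)
    (c₁ γ₁ : ℝ) (hc₁ : 0 < c₁) (hγ₁ : 0 < γ₁)
    (Λ : (d : ℕ) → MvPolynomial (Fin d × Fin 2) ℝ)
    (hnn : ∀ d : ℕ, ∀ l : Fin d → ℂ, (∀ j, l j ∈ H) → 0 ≤ evalPt d (Λ d) l)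
    (hdeg : ∀ d : ℕ, ∀ v : Fin d × Fin 2,
      ((MvPolynomial.degreeOf v (Λ d) : ℝ)) ≤ c₁ * (d : ℝ) ^ γ₁)
    (zM : (d : ℕ) → Fin d → ℂ)
    (hzMH : ∀ d : ℕ, ∀ j, zM d j ∈ H)
    (hmax : ∀ d : ℕ, ∀ l : Fin d → ℂ, (∀ j, l j ∈ H) →
      evalPt d (Λ d) l ≤ evalPt d (Λ d) (zM d)) :
    ∃ c : ℝ, 0 < c ∧ ∃ γ : ℝ, 0 < γ ∧ ∀ d : ℕ, 1 ≤ d → ∀ z : Fin d → ℂ,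
      (∀ j, z j ∈ H) → (∀ j, ‖z j - zM d j‖ ≤ Real.exp (-Real.sqrt d)) →
      evalPt d (Λ d) (zM d) * (1 - c * (d : ℝ) ^ γ * Real.exp (-Real.sqrt d)) ≤
        evalPt d (Λ d) z := by
  obtain ⟨a, b, c, e, hab, hce, rfl⟩ := hH
  set L := min (b - a) (e - c)
  have hL : 0 < L := lt_min (sub_pos.2 hab) (sub_pos.2 hce)
  refine ⟨8 * c₁ ^ 2 / L, by positivity, 1 + 2 * γ₁, by positivity, fun d hd z hz hclose => ?_⟩
  have hd₀ : (0 : ℝ) < d := by exact_mod_cast hd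
  set M := evalPt d (Λ d) (zM d) with hMdef
  rcases (hnn d (zM d) (hzMH d)).eq_or_lt with hM | hM
  · rw [hMdef, ← hM, zero_mul]
    exact hnn d z hz
  set coords : (Fin d → ℂ) → Fin d × Fin 2 → ℝ := fun l q => ![(l q.1).re, (l q.1).im] q.2
    with hcoords
  set lo : Fin d × Fin 2 → ℝ := fun q => ![a, c] q.2 with hlo
  set hi : Fin d × Fin 2 → ℝ := fun q => ![b, e] q.2 with hhi
  have hbox : ∀ l : Fin d → ℂ, (∀ j, l j ∈ {z : ℂ | z.re ∈ Set.Icc a b ∧ z.im ∈ Set.Icc c e}) →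
      coords l ∈ Set.Icc lo hi := by
    intro l hl
    constructor <;> rintro ⟨j, k⟩ <;> obtain ⟨⟨h₁, h₂⟩, h₃, h₄⟩ := hl j <;>
      fin_cases k <;> simpa [hcoords, hlo, hhi]
  have hbound : ∀ x ∈ Set.Icc lo hi, |MvPolynomial.eval x (Λ d)| ≤ M := by
    intro x hx
    set l : Fin d → ℂ := fun j => ⟨x (j, 0), x (j, 1)⟩ with hl
    have hlH : ∀ j, l j ∈ {z : ℂ | z.re ∈ Set.Icc a b ∧ z.im ∈ Set.Icc c e} := fun j =>
      ⟨⟨hx.1 (j, 0), hx.2 (j, 0)⟩, hx.1 (j, 1), hx.2 (j, 1)⟩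
    have hxl : MvPolynomial.eval x (Λ d) = evalPt d (Λ d) l := by
      have : x = coords l := by
        ext ⟨j, k⟩
        fin_cases k <;> rfl
      rw [this, evalPt]
    rw [hxl, abs_of_nonneg (hnn d l hlH)]
    exact hmax d l hlH
  have hdist : ∀ q, |coords z q - coords (zM d) q| ≤ Real.exp (-Real.sqrt d) := by
    rintro ⟨j, k⟩
    refine le_trans ?_ (hclose j)
    fin_cases k
    · exact Complex.abs_re_le_norm (z j - zM d j)
    · exact Complex.abs_im_le_norm (z j - zM d j)
  have hside : ∀ q, L ≤ hi q - lo q := by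
    rintro ⟨j, k⟩
    fin_cases k
    · exact min_le_left _ _
    · exact min_le_right _ _
  have h := MvPolynomial.abs_eval_sub_eval_le_of_abs_le_on_box hL hM hside (hdeg d) hbound
    (hbox _ (hzMH d)) (hbox _ hz) hdist
  change |evalPt d (Λ d) z - M| ≤ _ at h
  have hpow : (d : ℝ) ^ (1 + 2 * γ₁) = d * ((d : ℝ) ^ γ₁) ^ 2 := by
    rw [Real.rpow_add hd₀, Real.rpow_one, mul_comm 2 γ₁, Real.rpow_mul hd₀.le, Real.rpow_two]
  have hcard : (Fintype.card (Fin d × Fin 2) : ℝ) = d * 2 := by simp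
  have hconst : (Fintype.card (Fin d × Fin 2) : ℝ) *
      (4 * (c₁ * (d : ℝ) ^ γ₁) ^ 2 * M / L * Real.exp (-Real.sqrt d)) =
      M * (8 * c₁ ^ 2 / L * (d : ℝ) ^ (1 + 2 * γ₁) * Real.exp (-Real.sqrt d)) := by
    rw [hcard, hpow]
    ring
  rw [hconst] at h
  linarith [(abs_le.1 h).1]

end
end

section
/- Let H ⊂ ℂ be a rectangle and let τ be a positive Borel measure on H satisfying the density condition (3.10). Then for every continuous function w > 0 on H, the triple (H, w, τ) satisfies the weighted Bernstein–Markov inequality: for every ε > 0 there exists a constant c > 0 such that for all k ∈ ℕ and all analytic polynomials p ∈ ℂ[z] with deg p ≤ k, sup_{z∈H} |w(z)^k p(z)| ≤ c (1+ε)^k (∫_H |w(z)^k p(z)|² dτ(z))^{1/2}. -/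
open MeasureTheory Filter Set
open scoped ENNReal NNReal Topology BigOperators

noncomputable section

/-- Every complex number is the image of a nonzero point of the closed unit disc under the
Joukowski map `ζ ↦ (ζ + 1) ^ 2 / (4 * ζ)`, which folds the unit circle onto `[0, 1]`. -/
lemma exists_joukowski_preimage (z : ℂ) :
    ∃ ζ : ℂ, ζ ≠ 0 ∧ ‖ζ‖ ≤ 1 ∧ (ζ + 1) ^ 2 = 4 * ζ * z := by
  obtain ⟨d, hd⟩ := IsAlgClosed.exists_eq_mul_self ((2 * z - 1) ^ 2 - 1)
  have hprod : (2 * z - 1 + d) * (2 * z - 1 - d) = 1 := by linear_combination hd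
  have hnorm : ‖2 * z - 1 + d‖ * ‖2 * z - 1 - d‖ = 1 := by rw [← norm_mul, hprod, norm_one]
  rcases le_total ‖2 * z - 1 + d‖ 1 with h | h
  · exact ⟨2 * z - 1 + d, left_ne_zero_of_mul_eq_one hprod, h, by linear_combination -hd⟩
  · refine ⟨2 * z - 1 - d, right_ne_zero_of_mul_eq_one hprod, ?_, by linear_combination -hd⟩
    nlinarith [norm_nonneg (2 * z - 1 - d)]

/-- Joukowski preimages of points near `0` lie near the unit circle. -/
lemma one_le_mul_norm_of_joukowski {s : ℝ} (hs : 0 < s) {z ζ : ℂ}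
    (hz : ‖z‖ ≤ s ^ 2 / (4 * (1 + s))) (h : (ζ + 1) ^ 2 = 4 * ζ * z) :
    1 ≤ (1 + s) * ‖ζ‖ := by
  have h₁ : ‖ζ + 1‖ ^ 2 = 4 * ‖ζ‖ * ‖z‖ := by rw [← norm_pow, h]; simp
  have h₂ : ‖ζ - 1‖ ^ 2 = 4 * ‖ζ‖ * ‖z - 1‖ := by
    rw [← norm_pow, show (ζ - 1) ^ 2 = 4 * ζ * (z - 1) by linear_combination h]; simp
  have h₃ := parallelogram_law_with_norm ℝ ζ 1
  have h₄ : ‖z - 1‖ ≤ ‖z‖ + 1 := by simpa using norm_sub_le z 1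
  rw [norm_one] at h₃
  have hx := norm_nonneg ζ
  generalize ‖ζ‖ = x at *
  rw [le_div_iff₀ (by positivity)] at hz
  by_contra! hlt
  have h₅ : (1 - x) ^ 2 ≤ 4 * x * ‖z‖ := by nlinarith [mul_le_mul_of_nonneg_left h₄ hx]
  have h₆ : (1 + s) * (1 - x) ^ 2 ≤ x * s ^ 2 := by nlinarith
  have h₇ : s < (1 + s) * (1 - x) := by linarith
  have h₈ : s ^ 2 < ((1 + s) * (1 - x)) ^ 2 := by gcongr
  nlinarith [mul_le_mul_of_nonneg_left h₆ (by linarith : 0 ≤ 1 + s), mul_pos hs hs]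

/-- Bernstein–Walsh inequality near an endpoint of a segment. -/
lemma norm_eval_le_of_forall_Icc {p : Polynomial ℂ} {k : ℕ} (hp : p.natDegree ≤ k) {M s : ℝ}
    (hs : 0 < s) (hM : ∀ t ∈ Icc (0 : ℝ) 1, ‖p.eval (t : ℂ)‖ ≤ M) {z : ℂ}
    (hz : ‖z‖ ≤ s ^ 2 / (4 * (1 + s))) : ‖p.eval z‖ ≤ M * (1 + s) ^ k := by
  obtain ⟨ζ, hζ0, hζ1, hζ⟩ := exists_joukowski_preimage z
  have hM0 : 0 ≤ M := (norm_nonneg _).trans (hM 0 (by simp))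
  set Q : ℂ → ℂ := fun x ↦
    ∑ i ∈ Finset.range (k + 1), p.coeff i * ((x + 1) ^ 2 / 4) ^ i * x ^ (k - i)
  have hQ : ∀ x y : ℂ, (x + 1) ^ 2 = 4 * x * y → Q x = x ^ k * p.eval y := by
    intro x y hxy
    rw [Polynomial.eval_eq_sum_range' (Nat.lt_succ_of_le hp), Finset.mul_sum]
    refine Finset.sum_congr rfl fun i hi ↦ ?_
    have hik : i + (k - i) = k := by have := Finset.mem_range.1 hi; lia
    rw [hxy, show 4 * x * y / 4 = x * y by ring, mul_pow]
    conv_rhs => rw [← hik, pow_add]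
    ring
  have hcirc : ∀ x ∈ frontier (Metric.ball (0 : ℂ) 1), ‖Q x‖ ≤ M := by
    intro x hx
    rw [frontier_ball _ one_ne_zero, mem_sphere_zero_iff_norm] at hx
    have hconj : x * (starRingEnd ℂ) x = 1 := by rw [Complex.mul_conj']; simp [hx]
    have hre : (x + 1) ^ 2 = 4 * x * (((1 + x.re) / 2 : ℝ) : ℂ) := by
      push_cast
      linear_combination (-2 * x) * Complex.re_eq_add_conj x - hconj
    have := abs_le.1 (hx ▸ Complex.abs_re_le_norm x)
    rw [hQ _ _ hre, norm_mul, norm_pow, hx, one_pow, one_mul]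
    exact hM _ ⟨by linarith, by linarith⟩
  have hle : ‖Q ζ‖ ≤ M := by
    refine Complex.norm_le_of_forall_mem_frontier_norm_le Metric.isBounded_ball ?_ hcirc ?_
    · exact Differentiable.diffContOnCl (by fun_prop)
    · rw [closure_ball _ one_ne_zero]; simpa using hζ1
  rw [hQ _ _ hζ, norm_mul, norm_pow] at hle
  have h1 : 1 ≤ ((1 + s) * ‖ζ‖) ^ k := one_le_pow₀ (one_le_mul_norm_of_joukowski hs hz hζ)
  calc ‖p.eval z‖ ≤ ((1 + s) * ‖ζ‖) ^ k * ‖p.eval z‖ := le_mul_of_one_le_left (norm_nonneg _) h1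
    _ = (‖ζ‖ ^ k * ‖p.eval z‖) * (1 + s) ^ k := by rw [mul_pow]; ring
    _ ≤ M * (1 + s) ^ k := by gcongr

/-- Bernstein–Walsh inequality near the endpoint `z₀` of the segment `[z₀, z₀ + L]`. -/
lemma norm_eval_le_of_forall_segment {p : Polynomial ℂ} {k : ℕ} (hp : p.natDegree ≤ k)
    {M s : ℝ} (hs : 0 < s) {z₀ L : ℂ} (hL : L ≠ 0)
    (hM : ∀ t ∈ Icc (0 : ℝ) 1, ‖p.eval (z₀ + t * L)‖ ≤ M) {z : ℂ}
    (hz : ‖z - z₀‖ ≤ s ^ 2 / (4 * (1 + s)) * ‖L‖) : ‖p.eval z‖ ≤ M * (1 + s) ^ k := by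
  have heval : ∀ x, (p.comp (.C z₀ + .X * .C L)).eval x = p.eval (z₀ + x * L) := by
    simp [mul_comm L]
  have hdeg : (p.comp (.C z₀ + .X * .C L)).natDegree ≤ k := by
    refine Polynomial.natDegree_comp_le.trans ?_
    have : (Polynomial.C z₀ + .X * .C L).natDegree ≤ 1 := by compute_degree
    nlinarith
  have := norm_eval_le_of_forall_Icc hdeg hs (M := M) (fun t ht ↦ by rw [heval]; exact hM t ht)
    (z := (z - z₀) / L) (by rwa [norm_div, div_le_iff₀ (norm_pos_iff.2 hL)])
  rwa [heval, div_mul_cancel₀ _ hL, add_sub_cancel] at this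

/-- A function that is holomorphic and at most `B` times its central value on a disc is at least
half its central value on a concentric disc of radius smaller by a factor of order `B`. -/
lemma half_norm_le_of_norm_le {f : ℂ → ℂ} (hf : Differentiable ℂ f) {z₀ : ℂ} {R B : ℝ}
    (hR : 0 < R) (hB : 1 ≤ B) (hbound : ∀ z ∈ Metric.ball z₀ R, ‖f z‖ ≤ B * ‖f z₀‖)
    {z : ℂ} (hz : ‖z - z₀‖ ≤ R / (6 * B)) : ‖f z₀‖ / 2 ≤ ‖f z‖ := by
  rcases eq_or_ne (f z₀) 0 with h0 | h0
  · simp [h0]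
  have hA : 0 < ‖f z₀‖ := norm_pos_iff.2 h0
  have hmaps : MapsTo f (Metric.ball z₀ R) (Metric.closedBall (f z₀) (3 * B * ‖f z₀‖)) := by
    intro x hx
    rw [mem_closedBall_iff_norm]
    have := hbound x hx
    have := norm_sub_le (f x) (f z₀)
    nlinarith [le_mul_of_one_le_left hA.le hB]
  have hzR : z ∈ Metric.ball z₀ R := by
    rw [mem_ball_iff_norm]
    refine hz.trans_lt ?_
    rw [div_lt_iff₀ (by positivity)]
    nlinarith
  have hd := Complex.dist_le_div_mul_dist_of_mapsTo_ball hf.differentiableOn hmaps hzR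
  rw [dist_eq_norm, dist_eq_norm] at hd
  have h2 : 3 * B * ‖f z₀‖ / R * ‖z - z₀‖ ≤ ‖f z₀‖ / 2 := by
    calc 3 * B * ‖f z₀‖ / R * ‖z - z₀‖ ≤ 3 * B * ‖f z₀‖ / R * (R / (6 * B)) := by gcongr
      _ = ‖f z₀‖ / 2 := by field_simp; norm_num
  have := norm_sub_norm_le (f z₀) (f z)
  rw [norm_sub_rev] at this
  linarith

lemma IsRectangle.isCompact {H : Set ℂ} (hH : IsRectangle H) : IsCompact H := by
  obtain ⟨a, b, c, e, -, -, rfl⟩ := hH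
  exact isCompact_Icc.reProdIm isCompact_Icc

/-- Every point of a rectangle is an endpoint of a segment of prescribed small length contained
in the rectangle. -/
lemma IsRectangle.exists_segment {H : Set ℂ} (hH : IsRectangle H) :
    ∃ ℓ₀ : ℝ, 0 < ℓ₀ ∧ ∀ ℓ, 0 < ℓ → ℓ ≤ ℓ₀ → ∀ z ∈ H, ∃ L : ℂ, ‖L‖ = ℓ ∧
      ∀ t ∈ Icc (0 : ℝ) 1, z + t * L ∈ H := by
  obtain ⟨a, b, c, e, hab, -, rfl⟩ := hH
  refine ⟨(b - a) / 2, by linarith, fun ℓ hℓ hle z ⟨⟨h₁, h₂⟩, him⟩ ↦ ?_⟩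
  rcases le_total z.re ((a + b) / 2) with h | h
  · refine ⟨ℓ, by simp [hℓ.le], fun t ht ↦ ⟨?_, by simpa using him⟩⟩
    simp only [Complex.add_re, Complex.re_ofReal_mul, Complex.ofReal_re]
    constructor <;> nlinarith [ht.1, ht.2]
  · refine ⟨-ℓ, by simp [hℓ.le], fun t ht ↦ ⟨?_, by simpa using him⟩⟩
    simp only [Complex.add_re, Complex.re_ofReal_mul, Complex.neg_re, Complex.ofReal_re]
    constructor <;> nlinarith [ht.1, ht.2]

/-- A positive continuous function on a compact set has uniformly bounded ratios of values at
nearby points. -/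
lemma IsCompact.exists_le_mul_of_dist_lt {X : Type*} [PseudoMetricSpace X] {K : Set X}
    (hK : IsCompact K) {w : X → ℝ} (hw : ContinuousOn w K) (hpos : ∀ x ∈ K, 0 < w x) {s : ℝ}
    (hs : 0 < s) : ∃ δ > 0, ∀ x ∈ K, ∀ y ∈ K, dist x y < δ → w x ≤ (1 + s) * w y := by
  rcases K.eq_empty_or_nonempty with rfl | hne
  · exact ⟨1, one_pos, by simp⟩
  obtain ⟨x₀, hx₀, hmin⟩ := hK.exists_isMinOn hne hw
  obtain ⟨δ, hδ, h⟩ := Metric.uniformContinuousOn_iff.1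
    (hK.uniformContinuousOn_of_continuous hw) (s * w x₀) (mul_pos hs (hpos _ hx₀))
  refine ⟨δ, hδ, fun x hx y hy hxy ↦ ?_⟩
  have h₁ := (abs_lt.1 (h x hx y hy hxy)).2
  have h₂ : w x₀ ≤ w y := hmin hy
  nlinarith

/-- Chebyshev-type lower bound for the integral of a square over a set. -/
lemma mul_sqrt_le_sqrt_setIntegral_sq {X : Type*} [MeasurableSpace X] {μ : Measure X}
    [IsFiniteMeasure μ] {K D : Set X} (hK : MeasurableSet K) (hD : MeasurableSet D)
    (hμ : μ Kᶜ = 0) {g : X → ℝ} (hg : IntegrableOn (fun x ↦ g x ^ 2) K μ) {a m : ℝ} (ha : 0 ≤ a)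
    (hm : ENNReal.ofReal m ≤ μ D) (hle : ∀ x ∈ K ∩ D, a ≤ g x) :
    a * √m ≤ √(∫ x in K, g x ^ 2 ∂μ) := by
  have hmD : m ≤ μ.real (K ∩ D) := by
    rw [measureReal_def, inter_comm, measure_inter_conull' (measure_mono_null (by simp) hμ)]
    exact (ENNReal.ofReal_le_iff_le_toReal (measure_ne_top _ _)).1 hm
  refine Real.le_sqrt_of_sq_le ?_
  rcases le_total m 0 with h0 | h0
  · simpa [Real.sqrt_eq_zero_of_nonpos h0] using integral_nonneg fun x ↦ sq_nonneg (g x)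
  calc (a * √m) ^ 2 = a ^ 2 * m := by rw [mul_pow, Real.sq_sqrt h0]
    _ ≤ a ^ 2 * μ.real (K ∩ D) := by gcongr
    _ ≤ ∫ x in K ∩ D, g x ^ 2 ∂μ :=
      setIntegral_ge_of_const_le_real (hK.inter hD) (measure_ne_top _ _)
        (fun x hx ↦ by gcongr; exact hle x hx) (hg.mono_set inter_subset_left)
    _ ≤ ∫ x in K, g x ^ 2 ∂μ :=
      setIntegral_mono_set hg (ae_of_all _ fun x ↦ sq_nonneg _) inter_subset_left.eventuallyLE

/-- Proposition 3.1, the weighted Bernstein–Markov inequality. -/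
theorem weighted_bernstein_markov (H : Set ℂ) (hH : IsRectangle H)
    (τ : MeasureTheory.Measure ℂ) [MeasureTheory.IsFiniteMeasure τ]
    (hτH : τ Hᶜ = 0) (hτ : DensityCond H τ)
    (w : ℂ → ℝ) (hw : ContinuousOn w H) (hwpos : ∀ z ∈ H, 0 < w z) :
    ∀ ε : ℝ, 0 < ε → ∃ c : ℝ, 0 < c ∧ ∀ k : ℕ, ∀ p : Polynomial ℂ,
      p.natDegree ≤ k → ∀ z ∈ H,
        w z ^ k * ‖Polynomial.eval z p‖ ≤
          c * (1 + ε) ^ k *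
            Real.sqrt (∫ t in H, (w t ^ k) ^ 2 * ‖Polynomial.eval t p‖ ^ 2 ∂τ) := by
  intro ε hε
  obtain ⟨T, hT, r₀, hr₀, hdens⟩ := hτ
  have hHc := hH.isCompact
  obtain ⟨ℓ₀, hℓ₀, hseg⟩ := hH.exists_segment
  set q : ℝ := (1 + ε) ^ (1 / (1 + T)) with hq
  have hq1 : 1 < q := Real.one_lt_rpow (by linarith) (by positivity)
  have hq0 : 0 < q := by linarith
  have hqε : q * q ^ T = 1 + ε := by
    rw [← Real.rpow_one_add' hq0.le (by positivity), hq, ← Real.rpow_mul (by positivity)]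
    rw [one_div_mul_cancel (by positivity), Real.rpow_one]
  have hs : 0 < q - 1 := by linarith
  obtain ⟨δ, hδ, hratio⟩ := hHc.exists_le_mul_of_dist_lt hw hwpos hs
  rw [add_sub_cancel] at hratio
  obtain ⟨ℓ, hℓ, hℓle⟩ : ∃ ℓ, 0 < ℓ ∧ ℓ ≤ ℓ₀ ∧ ℓ < δ :=
    ⟨min ℓ₀ (δ / 2), by positivity, min_le_left _ _, by
      exact (min_le_right _ _).trans_lt (by linarith)⟩
  set η : ℝ := (q - 1) ^ 2 / (4 * (1 + (q - 1)))
  have hη : 0 < η := by positivity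
  set R : ℝ := min (η * ℓ) (min δ r₀)
  have hR : 0 < R := by positivity
  refine ⟨2 / √((R / 6) ^ T), by positivity, fun k p hp z hz ↦ ?_⟩
  have hcont : ContinuousOn (fun t ↦ w t ^ k * ‖p.eval t‖) H := by
    have := p.continuous
    fun_prop
  obtain ⟨z₀, hz₀, hmax⟩ := hHc.exists_isMaxOn ⟨z, hz⟩ hcont
  refine (hmax hz).trans ?_
  dsimp only
  have hB : 1 ≤ q ^ (2 * k) := one_le_pow₀ hq1.le
  have hw₀ := hwpos _ hz₀
  have hbound : ∀ t ∈ Metric.ball z₀ R, ‖p.eval t‖ ≤ q ^ (2 * k) * ‖p.eval z₀‖ := by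
    intro t ht
    obtain ⟨L, hL, hLH⟩ := hseg ℓ hℓ hℓle.1 z₀ hz₀
    have hM : ∀ x ∈ Icc (0 : ℝ) 1, ‖p.eval (z₀ + x * L)‖ ≤ q ^ k * ‖p.eval z₀‖ := by
      intro x hx
      have hd : dist z₀ (z₀ + x * L) < δ := by
        rw [dist_self_add_right, norm_mul, hL, Complex.norm_real, Real.norm_of_nonneg hx.1]
        nlinarith [hx.2]
      have hmx : w (z₀ + x * L) ^ k * ‖p.eval (z₀ + x * L)‖ ≤ w z₀ ^ k * ‖p.eval z₀‖ :=
        hmax (hLH x hx)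
      have hwx := hwpos _ (hLH x hx)
      have hwk : w z₀ ^ k ≤ (q * w (z₀ + x * L)) ^ k := by
        gcongr
        exact hratio _ hz₀ _ (hLH x hx) hd
      refine le_of_mul_le_mul_left (hmx.trans ?_) (pow_pos hwx k)
      calc w z₀ ^ k * ‖p.eval z₀‖ ≤ (q * w (z₀ + x * L)) ^ k * ‖p.eval z₀‖ := by gcongr
        _ = w (z₀ + x * L) ^ k * (q ^ k * ‖p.eval z₀‖) := by rw [mul_pow]; ring
    have hL0 : L ≠ 0 := norm_pos_iff.1 (hL ▸ hℓ)
    have ht' : ‖t - z₀‖ ≤ η * ‖L‖ := by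
      rw [hL]
      exact (mem_ball_iff_norm.1 ht).le.trans (min_le_left _ _)
    refine (norm_eval_le_of_forall_segment hp hs hL0 hM ht').trans_eq ?_
    rw [add_sub_cancel]
    ring
  set r : ℝ := R / (6 * q ^ (2 * k)) with hr
  have hr_pos : 0 < r := by positivity
  have hrR : r < R := by
    rw [hr, div_lt_iff₀ (by positivity)]
    nlinarith
  have hRδ : R ≤ δ := (min_le_right _ _).trans (min_le_left _ _)
  have hRr₀ : R ≤ r₀ := (min_le_right _ _).trans (min_le_right _ _)
  have hlow : ∀ t ∈ H ∩ Metric.closedBall z₀ r,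
      w z₀ ^ k * ‖p.eval z₀‖ / (2 * q ^ k) ≤ w t ^ k * ‖p.eval t‖ := by
    rintro t ⟨htH, ht⟩
    have hhalf := half_norm_le_of_norm_le p.differentiable hR hB hbound
      (mem_closedBall_iff_norm.1 ht)
    have hd : dist z₀ t < δ := by
      rw [dist_comm]; exact (Metric.mem_closedBall.1 ht).trans_lt (hrR.trans_le hRδ)
    have hwt := hwpos _ htH
    have hwk : w z₀ ^ k ≤ (q * w t) ^ k := by
      gcongr
      exact hratio _ hz₀ _ htH hd
    rw [div_le_iff₀ (by positivity)]
    calc w z₀ ^ k * ‖p.eval z₀‖ ≤ (q * w t) ^ k * (2 * ‖p.eval t‖) := by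
          gcongr; linarith
      _ = w t ^ k * ‖p.eval t‖ * (2 * q ^ k) := by rw [mul_pow]; ring
  have hmain := mul_sqrt_le_sqrt_setIntegral_sq hHc.measurableSet
    Metric.isClosed_closedBall.measurableSet hτH ((hcont.pow 2).integrableOn_compact hHc)
    (by positivity) (hdens z₀ hz₀ r hr_pos (hrR.le.trans hRr₀)) hlow
  simp only [mul_pow (_ ^ k)] at hmain
  have hsqrt : √(r ^ T) = √((R / 6) ^ T) / (q ^ T) ^ k := by
    rw [hr, ← div_div, Real.div_rpow (by positivity) (by positivity),
      Real.sqrt_div (by positivity), ← Real.rpow_natCast, ← Real.rpow_mul hq0.le,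
      ← Real.rpow_natCast, ← Real.rpow_mul hq0.le, Real.sqrt_eq_rpow (q ^ _),
      ← Real.rpow_mul hq0.le]
    push_cast
    ring_nf
  rw [hsqrt] at hmain
  rw [← hqε, mul_pow]
  have hS : 0 < √((R / 6) ^ T) := by positivity
  calc w z₀ ^ k * ‖p.eval z₀‖
      = 2 / √((R / 6) ^ T) * (q ^ k * (q ^ T) ^ k) *
        (w z₀ ^ k * ‖p.eval z₀‖ / (2 * q ^ k) * (√((R / 6) ^ T) / (q ^ T) ^ k)) := by
        field_simp
    _ ≤ _ := by gcongr

end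
end

section
/- Let H ⊂ ℂ be a rectangle, let τ be a finite positive Borel measure on H, and let φ > 0 be continuous on H. Then the functional μ ↦ inf_{k,ε} liminf_{d→∞} (1/d²) log J^φ_d(μ,k,ε), taking values in [−∞, ∞), is upper semicontinuous on the space M(H) of Borel probability measures on H equipped with the weak* topology. -/
open MeasureTheory Filter Set
open scoped ENNReal NNReal Topology BigOperators

noncomputable section

/-- Moments are weak* continuous on the probability measures carried by a rectangle. -/
theorem continuous_moment_of_isRectangle {H : Set ℂ} (hH : IsRectangle H) (n₁ n₂ : ℕ) :
    Continuous
      (fun μ : {ν : MeasureTheory.ProbabilityMeasure ℂ // (ν : MeasureTheory.Measure ℂ) Hᶜ = 0} =>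
        ∫ z, z.re ^ n₁ * z.im ^ n₂ ∂(μ.1 : MeasureTheory.Measure ℂ)) := by
  obtain ⟨a, b, c, e, hab, hce, rfl⟩ := hH
  let g : ℂ → ℝ := fun z =>
    (Set.projIcc a b hab.le z.re : ℝ) ^ n₁ * (Set.projIcc c e hce.le z.im : ℝ) ^ n₂
  have hg : Continuous g := by fun_prop
  have hbound : ∀ z, ‖g z‖ ≤ max |a| |b| ^ n₁ * max |c| |e| ^ n₂ := fun z => by
    have h₁ := (Set.projIcc a b hab.le z.re).2
    have h₂ := (Set.projIcc c e hce.le z.im).2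
    simp only [g, norm_mul, norm_pow, Real.norm_eq_abs]
    gcongr
    · exact abs_le_max_abs_abs h₁.1 h₁.2
    · exact abs_le_max_abs_abs h₂.1 h₂.2
  let G : BoundedContinuousFunction ℂ ℝ :=
    BoundedContinuousFunction.ofNormedAddCommGroup g hg _ hbound
  have hG : Continuous fun μ : MeasureTheory.ProbabilityMeasure ℂ =>
      ∫ z, G z ∂(μ : MeasureTheory.Measure ℂ) :=
    continuous_iff_continuousAt.2 fun μ =>
      ProbabilityMeasure.tendsto_iff_forall_integral_tendsto.1 tendsto_id G
  refine (hG.comp continuous_subtype_val).congr fun μ => integral_congr_ae ?_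
  filter_upwards [mem_ae_iff.2 μ.2] with z hz
  change (Set.projIcc a b hab.le z.re : ℝ) ^ n₁ * (Set.projIcc c e hce.le z.im : ℝ) ^ n₂ = _
  rw [Set.projIcc_of_mem _ hz.1, Set.projIcc_of_mem _ hz.2]

theorem elog_mono : Monotone elog := by
  intro x y hxy
  unfold elog
  split_ifs with hx hy hy' hx' hy hy' hy hy' <;> try simp_all
  exact Real.log_le_log (ENNReal.toReal_pos hx hx') (ENNReal.toReal_mono hy' hxy)

theorem GT_subset_GT {H : Set ℂ} {d k : ℕ} {μ ν : MeasureTheory.Measure ℂ} {ε δ : ℝ}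
    (h : ∀ n₁ n₂ : ℕ, n₁ + n₂ ≤ k →
      |(∫ z, z.re ^ n₁ * z.im ^ n₂ ∂μ) - ∫ z, z.re ^ n₁ * z.im ^ n₂ ∂ν| ≤ δ - ε) :
    GT H d ν k ε ⊆ GT H d μ k δ := by
  rintro l ⟨hl, hprob, hsupp, hmom⟩
  refine ⟨hl, hprob, hsupp, fun n₁ n₂ hn => ?_⟩
  have := abs_sub_le (∫ z, z.re ^ n₁ * z.im ^ n₂ ∂μ) (∫ z, z.re ^ n₁ * z.im ^ n₂ ∂ν)
    (∫ z, z.re ^ n₁ * z.im ^ n₂ ∂(empMeasure d l))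
  linarith [h n₁ n₂ hn, hmom n₁ n₂ hn]

/-- upper semicontinuity of `μ ↦ inf_{k,ε} liminf_d (1/d²) log J^φ_d(μ,k,ε)`
on the space of Borel probability measures on `H` with the weak* topology. -/
theorem liminf_functional_usc (H : Set ℂ) (hH : IsRectangle H)
    (τ : MeasureTheory.Measure ℂ) [MeasureTheory.IsFiniteMeasure τ] (hτH : τ Hᶜ = 0)
    (φ : ℂ → ℝ) (hφ : ContinuousOn φ H) (hφpos : ∀ z ∈ H, 0 < φ z) :
    UpperSemicontinuous
      (fun μ : {ν : MeasureTheory.ProbabilityMeasure ℂ // (ν : MeasureTheory.Measure ℂ) Hᶜ = 0} =>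
        ⨅ (k : ℕ) (ε : ℝ) (_ : 0 < ε),
          Filter.atTop.liminf fun d : ℕ =>
            ((((d : ℝ) ^ 2)⁻¹ : ℝ) : EReal) *
              elog (Jint H τ φ (μ.1 : MeasureTheory.Measure ℂ) k ε d)) := by
  intro μ y hy
  simp only [iInf_lt_iff] at hy
  obtain ⟨k, ε, hε, hlt⟩ := hy
  have hnear : ∀ᶠ ν : {ν : MeasureTheory.ProbabilityMeasure ℂ //
      (ν : MeasureTheory.Measure ℂ) Hᶜ = 0} in 𝓝 μ,
      ∀ n₁ ∈ Finset.range (k + 1), ∀ n₂ ∈ Finset.range (k + 1),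
        |(∫ z, z.re ^ n₁ * z.im ^ n₂ ∂(μ.1 : MeasureTheory.Measure ℂ)) -
          ∫ z, z.re ^ n₁ * z.im ^ n₂ ∂(ν.1 : MeasureTheory.Measure ℂ)| < ε / 2 := by
    simp only [Filter.eventually_all_finset]
    intro n₁ _ n₂ _
    have := (continuous_moment_of_isRectangle hH n₁ n₂).continuousAt (x := μ)
      (Metric.ball_mem_nhds _ (half_pos hε))
    filter_upwards [this] with ν hν
    rwa [mem_preimage, Metric.mem_ball', Real.dist_eq] at hν
  filter_upwards [hnear] with ν hν
  refine lt_of_le_of_lt (iInf₂_le_of_le k (ε / 2) (iInf_le_of_le (half_pos hε) ?_)) hlt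
  refine liminf_le_liminf (Eventually.of_forall fun d => ?_)
  refine mul_le_mul_of_nonneg_left (elog_mono (lintegral_mono_set (GT_subset_GT ?_))) ?_
  · intro n₁ n₂ hn
    have := hν n₁ (Finset.mem_range.2 (by omega)) n₂ (Finset.mem_range.2 (by omega))
    linarith
  · exact_mod_cast (by positivity : (0 : ℝ) ≤ ((d : ℝ) ^ 2)⁻¹)

end
end
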